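/- arXiv:1903.00726 — 4 statements merged into one kernel-verified Lean document; each statement's English description precedes it below -/
import Mathlib

section
/- Let $k$ be a field of characteristic $p > 0$, let $K = k((X))$ be the field of formal Laurent series over $k$, and let $P \subseteq K$ be the additive subgroup of Laurent series supported in nonpositive degrees. Then the inclusion $P \hookrightarrow K$ induces an isomorphism of additive groups $P/\mathscr{P}(P) \xrightarrow{\sim} K/\mathscr{P}(K)$, where $\mathscr{P}(f) = f - f^p$. Equivalently: $K = P + \mathscr{P}(K)$ and $P \cap \mathscr{P}(K) = \mathscr{P}(P)$. -/
/-- The solution of `g - g ^ p = c` with zero constant coefficient, given by its coefficients. -/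
def artinSchreierCoeff {k : Type*} [Field k] (p : ℕ) [Fact p.Prime] (c : ℕ → k) (n : ℕ) : k :=
  if _ : n = 0 then 0
  else c n + if p ∣ n then artinSchreierCoeff p c (n / p) ^ p else 0
termination_by n
decreasing_by exact Nat.div_lt_self (Nat.pos_of_ne_zero ‹_›) (Fact.out : p.Prime).one_lt

/-- The coefficients of a `p`-th power in characteristic `p`. -/
theorem PowerSeries.coeff_pow_char {k : Type*} [Field k] (p : ℕ) [Fact p.Prime] [CharP k p]
    (g : PowerSeries k) (n : ℕ) :
    (g ^ p).coeff n = if p ∣ n then g.coeff (n / p) ^ p else 0 := by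
  have hp : p ≠ 0 := (Fact.out : p.Prime).ne_zero
  have h : g ^ p = PowerSeries.map (frobenius k p) (PowerSeries.expand p hp g) :=
    (MvPowerSeries.map_frobenius_expand p hp (f := g)).symm
  rw [h, PowerSeries.coeff_map, PowerSeries.coeff_expand]
  split_ifs <;> simp [frobenius_def, hp]

/-- A power series without constant term is in the image of the Artin–Schreier operator. -/
theorem PowerSeries.exists_sub_pow_char_eq {k : Type*} [Field k] (p : ℕ) [Fact p.Prime]
    [CharP k p] (c : PowerSeries k) (hc : c.coeff 0 = 0) :
    ∃ g : PowerSeries k, c = g - g ^ p := by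
  have hp : p ≠ 0 := (Fact.out : p.Prime).ne_zero
  refine ⟨PowerSeries.mk (artinSchreierCoeff p fun n => c.coeff n), ?_⟩
  rw [eq_sub_iff_add_eq]
  ext n
  rw [map_add, PowerSeries.coeff_pow_char, PowerSeries.coeff_mk, PowerSeries.coeff_mk]
  conv_rhs => rw [artinSchreierCoeff]
  split_ifs with h₁ h₂ h₂
  · subst h₂
    rw [Nat.zero_div, artinSchreierCoeff]
    simp [hc, hp]
  · rfl
  · exact absurd (h₂ ▸ dvd_zero p) h₁
  · rfl

namespace LaurentSeries

/-- Laurent series supported in nonpositive degrees are closed under powers. -/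
theorem coeff_pow_eq_zero_of_pos {k : Type*} [Field k] {a : LaurentSeries k}
    (ha : ∀ n : ℤ, 0 < n → a.coeff n = 0) (m : ℕ) (n : ℤ) (hn : 0 < n) :
    (a ^ m).coeff n = 0 := by
  induction m generalizing n with
  | zero => rw [pow_zero, HahnSeries.coeff_one, if_neg hn.ne']
  | succ m ih =>
    rw [pow_succ, HahnSeries.coeff_mul]
    refine Finset.sum_eq_zero fun ij hij => ?_
    have hsum := (Finset.mem_antidiagonal.1 hij).2.2
    by_cases h : 0 < ij.1
    · rw [ih _ h, zero_mul]
    · rw [ha _ (by lia), mul_zero]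

/-- Laurent series supported in positive degrees are closed under positive powers. -/
theorem coeff_pow_eq_zero_of_nonpos {k : Type*} [Field k] {b : LaurentSeries k}
    (hb : ∀ n : ℤ, n ≤ 0 → b.coeff n = 0) {m : ℕ} (hm : m ≠ 0) (n : ℤ) (hn : n ≤ 0) :
    (b ^ m).coeff n = 0 := by
  induction m, Nat.one_le_iff_ne_zero.2 hm using Nat.le_induction generalizing n with
  | base => rw [pow_one, hb n hn]
  | succ m hm' ih =>
    rw [pow_succ, HahnSeries.coeff_mul]
    refine Finset.sum_eq_zero fun ij hij => ?_
    have hsum := (Finset.mem_antidiagonal.1 hij).2.2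
    by_cases h : ij.1 ≤ 0
    · rw [ih (by lia) _ h, zero_mul]
    · rw [hb _ (by lia), mul_zero]

/-- A Laurent series supported in positive degrees is in the image of the Artin–Schreier
operator. -/
theorem exists_sub_pow_char_eq {k : Type*} [Field k] (p : ℕ) [Fact p.Prime] [CharP k p]
    {b : LaurentSeries k} (hb : ∀ n : ℤ, n ≤ 0 → b.coeff n = 0) :
    ∃ g : LaurentSeries k, b = g - g ^ p := by
  obtain ⟨g, hg⟩ := PowerSeries.exists_sub_pow_char_eq p
    (PowerSeries.mk fun n : ℕ => b.coeff n) (by simp [hb])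
  refine ⟨HahnSeries.ofPowerSeries ℤ k g, ?_⟩
  rw [← map_pow, ← map_sub, ← hg]
  ext n
  rw [PowerSeries.coeff_coe]
  split_ifs with h
  · exact hb n h.le
  · rw [PowerSeries.coeff_mk, Int.natAbs_of_nonneg (not_lt.1 h)]

/-- A Laurent series is the sum of its parts in nonpositive and in positive degrees. -/
theorem exists_eq_nonpos_add_pos {k : Type*} [Field k] (f : LaurentSeries k) :
    ∃ a b : LaurentSeries k, (∀ n : ℤ, 0 < n → a.coeff n = 0) ∧
      (∀ n : ℤ, n ≤ 0 → b.coeff n = 0) ∧ f = a + b := by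
  refine ⟨HahnSeries.truncLT 1 f, f - HahnSeries.truncLT 1 f, fun n hn => ?_, fun n hn => ?_,
    (add_sub_cancel _ _).symm⟩
  · exact HahnSeries.coeff_truncLT_of_le (by lia) f
  · rw [HahnSeries.coeff_sub, HahnSeries.coeff_truncLT_of_lt (by lia), sub_self]

end LaurentSeries


/-- Let `k` be a field of characteristic `p > 0`, `K = k((X))` the field of
formal Laurent series, and `P ⊆ K` the additive subgroup of Laurent series supported in
nonpositive degrees.  With the Artin–Schreier operator `𝒫(f) = f - f ^ p`, the inclusion
`P ↪ K` induces an isomorphism `P / 𝒫(P) ≃ K / 𝒫(K)`; equivalently `K = P + 𝒫(K)` and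
`P ∩ 𝒫(K) = 𝒫(P)`. -/
theorem stmt_0 (k : Type*) [Field k] (p : ℕ) [Fact p.Prime] [CharP k p] :
    (∀ f : LaurentSeries k, ∃ a g : LaurentSeries k,
        (∀ n : ℤ, 0 < n → a.coeff n = 0) ∧ f = a + (g - g ^ p)) ∧
    (∀ f : LaurentSeries k,
        ((∀ n : ℤ, 0 < n → f.coeff n = 0) ∧ ∃ g : LaurentSeries k, f = g - g ^ p) ↔
          ∃ a : LaurentSeries k, (∀ n : ℤ, 0 < n → a.coeff n = 0) ∧ f = a - a ^ p) := by
  have hp : p ≠ 0 := (Fact.out : p.Prime).ne_zero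
  have : CharP (LaurentSeries k) p := charP_of_injective_ringHom HahnSeries.C_injective p
  refine ⟨fun f => ?_, fun f => ⟨?_, ?_⟩⟩
  · obtain ⟨a, b, ha, hb, rfl⟩ := LaurentSeries.exists_eq_nonpos_add_pos f
    obtain ⟨g, rfl⟩ := LaurentSeries.exists_sub_pow_char_eq p hb
    exact ⟨a, g, ha, rfl⟩
  · rintro ⟨hf, g, rfl⟩
    obtain ⟨a, b, ha, hb, rfl⟩ := LaurentSeries.exists_eq_nonpos_add_pos g
    have hsplit : a + b - (a + b) ^ p = (a - a ^ p) + (b - b ^ p) := by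
      rw [add_pow_char]
      ring
    have hzero : b - b ^ p = 0 := by
      ext n
      rcases le_or_gt n 0 with hn | hn
      · rw [HahnSeries.coeff_sub, hb n hn,
          LaurentSeries.coeff_pow_eq_zero_of_nonpos hb hp n hn, sub_zero, HahnSeries.coeff_zero]
      · have h := hf n hn
        rwa [hsplit, HahnSeries.coeff_add, HahnSeries.coeff_sub, ha n hn,
          LaurentSeries.coeff_pow_eq_zero_of_pos ha p n hn, sub_zero, zero_add] at h
    exact ⟨a, ha, by rw [hsplit, hzero, add_zero]⟩
  · rintro ⟨a, ha, rfl⟩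
    refine ⟨fun n hn => ?_, a, rfl⟩
    rw [HahnSeries.coeff_sub, ha n hn, LaurentSeries.coeff_pow_eq_zero_of_pos ha p n hn, sub_zero]
end

section
/- Let $k$ be a perfect field of characteristic $p > 0$, $K = k((X))$ the field of formal Laurent series, $R = k[[X]]$ the subring of power series, and $P \subseteq K$ the additive subgroup of Laurent series supported in nonpositive degrees. Let $D \le K$ be the additive subgroup generated by $\mathrm{Frob}(K) = \{g^p : g \in K\}$ together with $R$. Then the composite $P \hookrightarrow K \twoheadrightarrow K/D$ induces an isomorphism of additive groups $P/\mathrm{Frob}(P) \xrightarrow{\sim} K/D$, where $\mathrm{Frob}(P) = \{a^p : a \in P\}$. -/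
/-- The additive subgroup `D ≤ K = k((X))` generated by the `p`-th powers
`Frob(K) = {g^p : g ∈ K}` together with the power series subring `R = k[[X]]`. -/
noncomputable def frobPlusPowerSeries (k : Type*) [Field k] (p : ℕ) :
    AddSubgroup (LaurentSeries k) :=
  AddSubgroup.closure
    ({x : LaurentSeries k | ∃ g : LaurentSeries k, x = g ^ p} ∪
      Set.range (HahnSeries.ofPowerSeries ℤ k))

/-- The subring of Laurent series supported in nonpositive degrees. -/
def nonposSubring (k : Type*) [Field k] : Subring (LaurentSeries k) where
  carrier := {f | ∀ n : ℤ, 0 < n → f.coeff n = 0}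
  zero_mem' _ _ := HahnSeries.coeff_zero
  one_mem' n hn := by rw [HahnSeries.coeff_one, if_neg hn.ne']
  add_mem' {a b} ha hb n hn := by rw [HahnSeries.coeff_add, ha n hn, hb n hn, add_zero]
  neg_mem' {a} ha n hn := by rw [HahnSeries.coeff_neg, ha n hn, neg_zero]
  mul_mem' {a b} ha hb n hn := by
    rw [HahnSeries.coeff_mul]
    refine Finset.sum_eq_zero fun ij hij => ?_
    rw [Finset.mem_antidiagonal] at hij
    rcases lt_or_ge 0 ij.1 with h | h
    · rw [ha _ h, zero_mul]
    · rw [hb _ (by lia), mul_zero]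

theorem mem_nonposSubring {k : Type*} [Field k] {f : LaurentSeries k} :
    f ∈ nonposSubring k ↔ ∀ n : ℤ, 0 < n → f.coeff n = 0 :=
  Iff.rfl

/-- A Laurent series without terms of negative degree is a power series. -/
theorem mem_range_ofPowerSeries {k : Type*} [Field k] {f : LaurentSeries k}
    (hf : ∀ n : ℤ, n < 0 → f.coeff n = 0) : f ∈ (HahnSeries.ofPowerSeries ℤ k).range := by
  refine ⟨PowerSeries.mk fun n => f.coeff n, ?_⟩
  ext n
  rw [PowerSeries.coeff_coe]
  split_ifs with h
  · exact (hf n h).symm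
  · rw [PowerSeries.coeff_mk, Int.natAbs_of_nonneg (not_lt.mp h)]

theorem coeff_eq_zero_of_mem_range_ofPowerSeries {k : Type*} [Field k] {f : LaurentSeries k}
    (hf : f ∈ (HahnSeries.ofPowerSeries ℤ k).range) {n : ℤ} (hn : n < 0) : f.coeff n = 0 := by
  obtain ⟨r, rfl⟩ := hf
  rw [PowerSeries.coeff_coe, if_pos hn]

theorem exists_sub_mem_range_ofPowerSeries {k : Type*} [Field k] (f : LaurentSeries k) :
    ∃ a ∈ nonposSubring k, f - a ∈ (HahnSeries.ofPowerSeries ℤ k).range := by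
  refine ⟨HahnSeries.truncLT 1 f, fun n hn => HahnSeries.coeff_truncLT_of_le (by lia) f,
    mem_range_ofPowerSeries fun n hn => ?_⟩
  rw [HahnSeries.coeff_sub, HahnSeries.coeff_truncLT_of_lt (by lia), sub_self]

theorem eq_C_of_mem_nonposSubring {k : Type*} [Field k] {f : LaurentSeries k}
    (hf : f ∈ nonposSubring k) (hf' : f ∈ (HahnSeries.ofPowerSeries ℤ k).range) :
    f = HahnSeries.C (f.coeff 0) := by
  ext n
  rcases lt_trichotomy n 0 with h | rfl | h
  · rw [coeff_eq_zero_of_mem_range_ofPowerSeries hf' h, HahnSeries.C_apply,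
      HahnSeries.coeff_single_of_ne h.ne]
  · rw [HahnSeries.C_apply, HahnSeries.coeff_single_same]
  · rw [hf n h, HahnSeries.C_apply, HahnSeries.coeff_single_of_ne h.ne']

theorem charP_laurentSeries (k : Type*) [Field k] (p : ℕ) [CharP k p] :
    CharP (LaurentSeries k) p :=
  charP_of_injective_ringHom (f := (HahnSeries.C : k →+* LaurentSeries k))
    HahnSeries.C_injective p

theorem mem_frobPlusPowerSeries {k : Type*} [Field k] {p : ℕ} [Fact p.Prime] [CharP k p]
    {f : LaurentSeries k} :
    f ∈ frobPlusPowerSeries k p ↔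
      ∃ g : LaurentSeries k, f - g ^ p ∈ (HahnSeries.ofPowerSeries ℤ k).range := by
  have := charP_laurentSeries k p
  constructor
  · intro hf
    induction hf using AddSubgroup.closure_induction with
    | mem x hx =>
      rcases hx with ⟨g, rfl⟩ | hx
      · exact ⟨g, by rw [sub_self]; exact zero_mem _⟩
      · exact ⟨0, by rwa [zero_pow (Fact.out : p.Prime).ne_zero, sub_zero]⟩
    | zero => exact ⟨0, by
        rw [zero_pow (Fact.out : p.Prime).ne_zero, sub_zero]; exact zero_mem _⟩
    | add x y _ _ hx hy =>
      obtain ⟨g, hg⟩ := hx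
      obtain ⟨h, hh⟩ := hy
      exact ⟨g + h, by rw [add_pow_char, add_sub_add_comm]; exact add_mem hg hh⟩
    | neg x _ hx =>
      obtain ⟨g, hg⟩ := hx
      refine ⟨-g, ?_⟩
      have hneg : (-g) ^ p = -g ^ p := map_neg (frobenius (LaurentSeries k) p) g
      rw [hneg, ← neg_sub']
      exact neg_mem hg
  · rintro ⟨g, hg⟩
    rw [← add_sub_cancel (g ^ p) f]
    exact add_mem (AddSubgroup.subset_closure (.inl ⟨g, rfl⟩))
      (AddSubgroup.subset_closure (.inr hg))

/-- Let `k` be a perfect field of characteristic `p > 0`, `K = k((X))`,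
`R = k[[X]]`, and `P ⊆ K` the additive subgroup of Laurent series supported in nonpositive
degrees.  Let `D ≤ K` be the additive subgroup generated by `Frob(K) = {g^p : g ∈ K}` and `R`.
Then the composite `P ↪ K ↠ K/D` induces an isomorphism `P/Frob(P) ≃ K/D`, i.e.
every `f ∈ K` is congruent mod `D` to some element of `P`, and an element of `P` lies in `D`
exactly when it lies in `Frob(P) = {a^p : a ∈ P}`. -/
theorem stmt_2 (k : Type*) [Field k] (p : ℕ) [Fact p.Prime] [CharP k p] [PerfectField k] :
    (∀ f : LaurentSeries k, ∃ a : LaurentSeries k,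
        (∀ n : ℤ, 0 < n → a.coeff n = 0) ∧ f - a ∈ frobPlusPowerSeries k p) ∧
    (∀ a : LaurentSeries k, (∀ n : ℤ, 0 < n → a.coeff n = 0) →
        (a ∈ frobPlusPowerSeries k p ↔
          ∃ b : LaurentSeries k, (∀ n : ℤ, 0 < n → b.coeff n = 0) ∧ a = b ^ p)) := by
  have := charP_laurentSeries k p
  refine ⟨fun f => ?_, fun a ha => ⟨fun haD => ?_, ?_⟩⟩
  · obtain ⟨a, ha, hfa⟩ := exists_sub_mem_range_ofPowerSeries f
    exact ⟨a, ha, AddSubgroup.subset_closure (.inr hfa)⟩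
  · obtain ⟨g, hg⟩ := mem_frobPlusPowerSeries.mp haD
    obtain ⟨b, hb, hgb⟩ := exists_sub_mem_range_ofPowerSeries g
    have hab : a - b ^ p ∈ (HahnSeries.ofPowerSeries ℤ k).range := by
      have h := add_mem hg (pow_mem hgb p)
      rwa [sub_pow_char, sub_add_sub_cancel] at h
    have hC := eq_C_of_mem_nonposSubring (sub_mem ha (pow_mem hb p)) hab
    have : ExpChar k p := .prime Fact.out
    have : PerfectRing k p := PerfectField.toPerfectRing p
    obtain ⟨d, hd⟩ := surjective_frobenius k p ((a - b ^ p).coeff 0)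
    refine ⟨b + HahnSeries.C d, mem_nonposSubring.mp (add_mem hb fun n hn => ?_), ?_⟩
    · rw [HahnSeries.C_apply, HahnSeries.coeff_single_of_ne hn.ne']
    · rw [add_pow_char, ← map_pow, ← frobenius_def p d, hd, ← hC, add_sub_cancel]
  · rintro ⟨b, -, rfl⟩
    exact AddSubgroup.subset_closure (.inl ⟨b, rfl⟩)
end

section
/- Let $k$ be a perfect field of characteristic $p > 0$, $K = k((X))$ the field of formal Laurent series, $R = k[[X]]$ the subring of power series, and $P \subseteq K$ the additive subgroup of Laurent series supported in nonpositive degrees. Then the assignment $(a \bmod \mathrm{Frob}(P),\ b \bmod \mathrm{Frob}(R)) \mapsto (a + b) \bmod \mathrm{Frob}(K)$ is a well-defined isomorphism of additive groups $P/\mathrm{Frob}(P) \times R/\mathrm{Frob}(R) \xrightarrow{\sim} K/\mathrm{Frob}(K)$, where $\mathrm{Frob}(A) = \{a^p : a \in A\}$. -/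
/-- A Laurent series supported in nonpositive degrees times another such series is again
supported in nonpositive degrees. -/
theorem LaurentSeries.coeff_mul_eq_zero_of_pos {k : Type*} [Semiring k] {a b : LaurentSeries k}
    (ha : ∀ n : ℤ, 0 < n → a.coeff n = 0) (hb : ∀ n : ℤ, 0 < n → b.coeff n = 0) :
    ∀ n : ℤ, 0 < n → (a * b).coeff n = 0 := by
  intro n hn
  rw [HahnSeries.coeff_mul]
  refine Finset.sum_eq_zero fun ij hij => ?_
  have hsum : ij.1 + ij.2 = n := (Finset.mem_antidiagonal.mp hij).2.2
  rcases lt_or_ge 0 ij.1 with h | h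
  · rw [ha _ h, zero_mul]
  · rw [hb _ (by omega), mul_zero]

theorem LaurentSeries.coeff_pow_eq_zero_of_pos_s4 {k : Type*} [Semiring k] {a : LaurentSeries k}
    (ha : ∀ n : ℤ, 0 < n → a.coeff n = 0) (m : ℕ) :
    ∀ n : ℤ, 0 < n → (a ^ m).coeff n = 0 := by
  induction m with
  | zero =>
    intro n hn
    rw [pow_zero, HahnSeries.coeff_one, if_neg hn.ne']
  | succ m ih =>
    rw [pow_succ]
    exact LaurentSeries.coeff_mul_eq_zero_of_pos ih ha

/-- Every Laurent series is the sum of one supported in nonpositive degrees and a power series. -/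
theorem LaurentSeries.exists_eq_add_ofPowerSeries {k : Type*} [Ring k] (f : LaurentSeries k) :
    ∃ (a : LaurentSeries k) (c : PowerSeries k),
      (∀ n : ℤ, 0 < n → a.coeff n = 0) ∧ f = a + HahnSeries.ofPowerSeries ℤ k c := by
  refine ⟨f - HahnSeries.ofPowerSeries ℤ k (PowerSeries.mk fun n => f.coeff n),
    PowerSeries.mk fun n => f.coeff n, fun n hn => ?_, (sub_add_cancel _ _).symm⟩
  lift n to ℕ using hn.le
  rw [HahnSeries.coeff_sub, HahnSeries.ofPowerSeries_apply_coeff, PowerSeries.coeff_mk, sub_self]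

/-- A power series supported in nonpositive degrees is constant. -/
theorem PowerSeries.eq_C_of_coeff_ofPowerSeries_eq_zero {k : Type*} [Semiring k]
    {e : PowerSeries k} (he : ∀ n : ℤ, 0 < n → (HahnSeries.ofPowerSeries ℤ k e).coeff n = 0) :
    e = PowerSeries.C (PowerSeries.constantCoeff e) := by
  ext n
  rcases Nat.eq_zero_or_pos n with rfl | hn
  · simp
  · have h := he n (by exact_mod_cast hn)
    rw [HahnSeries.ofPowerSeries_apply_coeff] at h
    rw [h, PowerSeries.coeff_C, if_neg hn.ne']


/-- Let `k` be a perfect field of characteristic `p > 0`, `K = k((X))`,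
`R = k[[X]]` (viewed inside `K`), and `P ⊆ K` the additive subgroup of Laurent series
supported in nonpositive degrees.  The assignment
`(a mod Frob(P), b mod Frob(R)) ↦ (a + b) mod Frob(K)` is a well-defined isomorphism of
additive groups `P/Frob(P) × R/Frob(R) ≃ K/Frob(K)`, where `Frob(A) = {a^p : a ∈ A}`.
This is rendered elementwise: the map is well defined and injective (the `iff` below) and
surjective (the second clause). -/
theorem stmt_4 (k : Type*) [Field k] (p : ℕ) [Fact p.Prime] [CharP k p] [PerfectField k] :
    (∀ (a b : LaurentSeries k) (c d : PowerSeries k),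
        (∀ n : ℤ, 0 < n → a.coeff n = 0) → (∀ n : ℤ, 0 < n → b.coeff n = 0) →
        ((∃ g : LaurentSeries k,
            (a + HahnSeries.ofPowerSeries ℤ k c) - (b + HahnSeries.ofPowerSeries ℤ k d)
              = g ^ p) ↔
          ((∃ a' : LaurentSeries k, (∀ n : ℤ, 0 < n → a'.coeff n = 0) ∧ a - b = a' ^ p) ∧
            (∃ c' : PowerSeries k, c - d = c' ^ p)))) ∧
    (∀ f : LaurentSeries k, ∃ (a : LaurentSeries k) (c : PowerSeries k),
        (∀ n : ℤ, 0 < n → a.coeff n = 0) ∧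
        ∃ g : LaurentSeries k, f - (a + HahnSeries.ofPowerSeries ℤ k c) = g ^ p) := by
  have : CharP (LaurentSeries k) p :=
    charP_of_injective_ringHom (HahnSeries.C_injective (Γ := ℤ) (R := k)) p
  have : ExpChar k p := ExpChar.prime Fact.out
  have hinj := HahnSeries.ofPowerSeries_injective (Γ := ℤ) (R := k)
  refine ⟨fun a b c d ha hb => ⟨?_, ?_⟩, fun f => ?_⟩
  · rintro ⟨g, hg⟩
    obtain ⟨g₁, g₂, hg₁, rfl⟩ := LaurentSeries.exists_eq_add_ofPowerSeries g
    rw [add_pow_char] at hg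
    have key : a - b - g₁ ^ p = HahnSeries.ofPowerSeries ℤ k (g₂ ^ p - (c - d)) := by
      simp only [map_sub, map_pow]
      linear_combination hg
    have hconst := PowerSeries.eq_C_of_coeff_ofPowerSeries_eq_zero (e := g₂ ^ p - (c - d)) <| by
      intro n hn
      rw [← key, HahnSeries.coeff_sub, HahnSeries.coeff_sub, ha n hn, hb n hn,
        LaurentSeries.coeff_pow_eq_zero_of_pos_s4 hg₁ p n hn, sub_zero, sub_zero]
    obtain ⟨γ, hγ⟩ :=
      surjective_frobenius k p (PowerSeries.constantCoeff (g₂ ^ p - (c - d)))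
    rw [← hγ, frobenius_def, map_pow] at hconst
    rw [hconst, map_pow] at key
    refine ⟨⟨g₁ + HahnSeries.ofPowerSeries ℤ k (PowerSeries.C γ), fun n hn => ?_, ?_⟩,
      g₂ - PowerSeries.C γ, ?_⟩
    · rw [HahnSeries.coeff_add, hg₁ n hn, HahnSeries.ofPowerSeries_C, HahnSeries.C_apply,
        HahnSeries.coeff_single_of_ne hn.ne', add_zero]
    · rw [add_pow_char]
      linear_combination key
    · apply hinj
      have h := congrArg (HahnSeries.ofPowerSeries ℤ k) hconst
      simp only [map_sub, map_pow] at h ⊢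
      rw [sub_pow_char]
      linear_combination -h
  · rintro ⟨⟨a', -, h₁⟩, c', h₂⟩
    refine ⟨a' + HahnSeries.ofPowerSeries ℤ k c', ?_⟩
    have h := congrArg (HahnSeries.ofPowerSeries ℤ k) h₂
    rw [map_sub, map_pow] at h
    rw [add_pow_char]
    linear_combination h₁ + h
  · obtain ⟨a, c, ha, rfl⟩ := LaurentSeries.exists_eq_add_ofPowerSeries f
    exact ⟨a, c, ha, 0, by rw [sub_self, zero_pow (Fact.out : p.Prime).ne_zero]⟩
end

section
/- Let $k$ be a field of characteristic $p > 0$ and $h \in k[T]$ a nonzero polynomial. The quotient of the additive group of the localization $k[T][1/h]$ by the additive subgroup of $p$-th powers $\{f^p : f \in k[T][1/h]\}$ is infinite. -/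
/-- The additive subgroup `Frob(R) = {g^p : g ∈ R}` of `p`-th powers of a commutative ring
(given as the additive subgroup generated by the set of `p`-th powers; in characteristic `p`
this set is already an additive subgroup). -/
def frobAddSubgroup (R : Type*) [CommRing R] (p : ℕ) : AddSubgroup R :=
  AddSubgroup.closure {x : R | ∃ g : R, x = g ^ p}

open Polynomial in
theorem Polynomial.eq_of_mul_X_pow_sub_eq_pow {k : Type*} [Field k] {p : ℕ} [CharP k p]
    {s a : k[X]} (hs : s ≠ 0) {m n : ℕ}
    (h : s ^ p * (X ^ (p * m + 1) - X ^ (p * n + 1)) = a ^ p) (hp : p ≠ 0) : m = n := by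
  have hd := congrArg derivative h
  have hX : s ^ p * (X ^ (p * m) - X ^ (p * n)) = 0 := by
    simpa [derivative_mul, derivative_pow, CharP.cast_eq_zero] using hd
  have hmn : (X ^ (p * m) : k[X]) = X ^ (p * n) :=
    sub_eq_zero.mp ((mul_eq_zero.mp hX).resolve_left (pow_ne_zero p hs))
  have := congrArg natDegree hmn
  rw [natDegree_X_pow, natDegree_X_pow] at this
  exact Nat.eq_of_mul_eq_mul_left (Nat.pos_of_ne_zero hp) this

theorem mem_frobAddSubgroup_iff {R : Type*} [CommRing R] {p : ℕ} [Fact p.Prime] [CharP R p]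
    {x : R} : x ∈ frobAddSubgroup R p ↔ ∃ g : R, x = g ^ p := by
  refine ⟨fun hx => ?_, fun hx => AddSubgroup.subset_closure hx⟩
  induction hx using AddSubgroup.closure_induction with
  | mem x hx => exact hx
  | zero => exact ⟨0, (zero_pow (Fact.out : p.Prime).ne_zero).symm⟩
  | add x y _ _ hx hy =>
    obtain ⟨a, rfl⟩ := hx
    obtain ⟨b, rfl⟩ := hy
    exact ⟨a + b, (add_pow_char a b p).symm⟩
  | neg x _ hx =>
    obtain ⟨a, rfl⟩ := hx
    refine ⟨0 - a, ?_⟩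
    rw [sub_pow_char, zero_pow (Fact.out : p.Prime).ne_zero, zero_sub]

/-- Let `k` be a field of characteristic `p > 0` and `h ∈ k[T]` a nonzero
polynomial.  The quotient of the additive group of the localization `k[T][1/h]` by the
additive subgroup of `p`-th powers `{f^p : f ∈ k[T][1/h]}` is infinite. -/
theorem stmt_10 (k : Type*) [Field k] (p : ℕ) [Fact p.Prime] [CharP k p]
    (h : Polynomial k) (hh : h ≠ 0) :
    Infinite (Localization.Away h ⧸ frobAddSubgroup (Localization.Away h) p) := by
  have hp : p ≠ 0 := (Fact.out : p.Prime).ne_zero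
  have hle : Submonoid.powers h ≤ nonZeroDivisors (Polynomial k) :=
    powers_le_nonZeroDivisors_of_noZeroDivisors hh
  have hinj : Function.Injective (algebraMap (Polynomial k) (Localization.Away h)) :=
    IsLocalization.injective _ hle
  have : CharP (Localization.Away h) p := charP_of_injective_algebraMap hinj p
  refine Infinite.of_injective (fun n : ℕ => (QuotientAddGroup.mk
    (algebraMap (Polynomial k) (Localization.Away h) (Polynomial.X ^ (p * n + 1))) :
      Localization.Away h ⧸ frobAddSubgroup (Localization.Away h) p)) fun n m hnm => ?_
  obtain ⟨g, hg⟩ := mem_frobAddSubgroup_iff.mp (QuotientAddGroup.eq.mp hnm)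
  obtain ⟨⟨a, s⟩, has⟩ := IsLocalization.surj (Submonoid.powers h) g
  refine (Polynomial.eq_of_mul_X_pow_sub_eq_pow (p := p) (s := s) (a := a)
    (nonZeroDivisors.ne_zero (hle s.2)) (hinj ?_) hp).symm
  rw [map_mul, map_pow, map_sub, map_pow _ a, ← has, mul_pow, ← hg]
  ring
end
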